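/- arXiv:1105.3007 — 3 statements merged into one kernel-verified Lean document; each statement's English description precedes it below -/
import Mathlib

section
/- Let m : ℝ^p → ℝ^J satisfy m(α₀) = 0. If m is differentiable at α₀ with derivative m′ : ℝ^p → ℝ^J (a linear map) of rank p (equivalently, m′ is injective), then α₀ is locally identified: there exists ε > 0 such that m(α) ≠ 0 for every α with 0 < |α − α₀| < ε. -/
/-- Parametric local identification: if `m : ℝ^p → ℝ^J` vanishes at `α₀`,
is differentiable at `α₀` with derivative `m'` of full rank `p` (i.e. `m'` injective),
then `α₀` is locally identified: `m α ≠ 0` for all `α ≠ α₀` close enough to `α₀`. -/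
theorem stmt_0 {p J : ℕ} (m : EuclideanSpace ℝ (Fin p) → EuclideanSpace ℝ (Fin J))
    (α₀ : EuclideanSpace ℝ (Fin p))
    (m' : EuclideanSpace ℝ (Fin p) →L[ℝ] EuclideanSpace ℝ (Fin J))
    (hm0 : m α₀ = 0)
    (hdiff : HasFDerivAt m m' α₀)
    (hrank : Function.Injective m') :
    ∃ ε > 0, ∀ α : EuclideanSpace ℝ (Fin p),
      0 < ‖α - α₀‖ → ‖α - α₀‖ < ε → m α ≠ 0 := by
  obtain ⟨K, -, hK⟩ := LinearMap.exists_antilipschitzWith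
    (m' : EuclideanSpace ℝ (Fin p) →ₗ[ℝ] EuclideanSpace ℝ (Fin J))
    (LinearMap.ker_eq_bot.2 hrank)
  have h : ∀ᶠ z in nhdsWithin α₀ {α₀}ᶜ, m z ≠ 0 := hdiff.eventually_ne ⟨K, hK⟩
  rw [eventually_nhdsWithin_iff, Metric.eventually_nhds_iff] at h
  obtain ⟨ε, hε, h⟩ := h
  refine ⟨ε, hε, fun α h0 h1 => h (by rwa [dist_eq_norm]) ?_⟩
  intro he
  rw [Set.mem_singleton_iff.1 he] at h0
  simp at h0
end

section
/- Let A and B be Banach spaces, and let m : A → B satisfy m(α₀) = 0. Suppose m is Fréchet differentiable at α₀ with (continuous linear) derivative m′ : A → B, that there exists ε > 0 such that m′(α − α₀) ≠ 0 for all α ≠ α₀ with ‖α − α₀‖_A < ε, and that m′ is surjective onto B. Then there exists ε̃ with 0 < ε̃ ≤ ε such that m(α) ≠ 0 for all α ≠ α₀ with ‖α − α₀‖_A < ε̃. -/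
/-- Theorem 1 of the paper. In Banach spaces, if `m` is Fréchet
differentiable at `α₀` with derivative `m'`, the rank condition holds on a ball of
radius `ε`, and `m'` is onto, then `α₀` is locally identified on a ball of radius
`ε̃` with `0 < ε̃ ≤ ε`. -/
theorem stmt_1 {A B : Type*} [NormedAddCommGroup A] [NormedSpace ℝ A] [CompleteSpace A]
    [NormedAddCommGroup B] [NormedSpace ℝ B] [CompleteSpace B]
    (m : A → B) (α₀ : A) (m' : A →L[ℝ] B)
    (hm0 : m α₀ = 0)
    (hdiff : HasFDerivAt m m' α₀)
    (ε : ℝ) (hε : 0 < ε)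
    (hrank : ∀ α : A, α ≠ α₀ → ‖α - α₀‖ < ε → m' (α - α₀) ≠ 0)
    (hsurj : Function.Surjective m') :
    ∃ ε' : ℝ, 0 < ε' ∧ ε' ≤ ε ∧ ∀ α : A, α ≠ α₀ → ‖α - α₀‖ < ε' → m α ≠ 0 := by
  have hker : ∀ h : A, m' h = 0 → h = 0 := by
    intro h hh
    by_contra hne
    have hpos : 0 < ‖h‖ := norm_pos_iff.2 hne
    have hc : 0 < ε / 2 / ‖h‖ := by positivity
    refine hrank (α₀ + (ε / 2 / ‖h‖) • h) ?_ ?_ ?_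
    · simp [hne, hε.ne']
    · rw [add_sub_cancel_left, norm_smul, Real.norm_of_nonneg hc.le,
        div_mul_cancel₀ _ hpos.ne']
      linarith
    · rw [add_sub_cancel_left, map_smul, hh, smul_zero]
  have hinj : Function.Injective m' := (injective_iff_map_eq_zero m').2 hker
  have hclosed : IsClosed (Set.range m') := by
    rw [hsurj.range_eq]
    exact isClosed_univ
  obtain ⟨C, hC⟩ := m'.antilipschitz_of_injective_of_isClosed_range hinj hclosed
  have hev := hdiff.eventually_ne (c := 0) ⟨C, hC⟩
  rw [eventually_nhdsWithin_iff, Metric.eventually_nhds_iff] at hev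
  obtain ⟨δ, hδ, H⟩ := hev
  refine ⟨min δ ε, lt_min hδ hε, min_le_right _ _, fun α hα hlt => ?_⟩
  exact H (by rw [dist_eq_norm]; exact lt_of_lt_of_le hlt (min_le_left _ _)) hα
end

section
/- Let (p_j)_{j∈ℕ} be positive reals with Σ_j p_j = 1, and let μ be the measure on ℕ with μ({j}) = p_j. Let f : ℝ → ℝ be bounded and twice continuously differentiable with bounded second derivative, f(0) = 0 and f′(0) = 1. Define m : L⁴(μ) → L²(μ) by m(α)(j) = f(α(j)). Then m is well defined and, with L = sup_x |f″(x)|/2, satisfies ‖m(α) − m(0) − α‖_{L²(μ)} ≤ L ‖α‖²_{L⁴(μ)} for all α ∈ L⁴(μ); in particular m is Fréchet differentiable at α₀ = 0 with derivative m′h = h, the inclusion map of L⁴(μ) into L²(μ). -/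
theorem aux_pointwise (f : ℝ → ℝ) (hf : ContDiff ℝ 2 f)
    (hf''bdd : ∃ C, ∀ x, |iteratedDeriv 2 f x| ≤ C)
    (hf'0 : deriv f 0 = 1) (x : ℝ) :
    |f x - f 0 - x| ≤ (⨆ x : ℝ, |iteratedDeriv 2 f x|) / 2 * x ^ 2 := by
  rcases eq_or_ne 0 x with rfl | hx
  · simp
  obtain ⟨y, -, hy⟩ := taylor_mean_remainder_lagrange_iteratedDeriv (n := 1) hx
    (f := f) (by norm_num; exact hf.contDiffOn)
  have hd : derivWithin f (Set.uIcc 0 x) 0 = 1 := by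
    rw [← hf'0]
    exact ((hf.differentiable (by norm_num)) 0).derivWithin
      (uniqueDiffOn_uIcc hx 0 Set.left_mem_uIcc)
  have hM : |iteratedDeriv 2 f y| ≤ ⨆ x : ℝ, |iteratedDeriv 2 f x| := by
    obtain ⟨C, hC⟩ := hf''bdd
    exact le_ciSup (f := fun x => |iteratedDeriv 2 f x|)
      ⟨C, by rintro _ ⟨z, rfl⟩; exact hC z⟩ y
  rw [show (1 : ℕ) = 0 + 1 from rfl, taylorWithinEval_succ] at hy
  simp [iteratedDerivWithin_one, hd] at hy
  have : f x - f 0 - x = iteratedDeriv 2 f y * x ^ 2 / 2 := by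
    rw [← hy]; ring
  rw [this, abs_div, abs_mul, abs_of_nonneg (sq_nonneg x), abs_two]
  nlinarith [mul_le_mul_of_nonneg_right hM (sq_nonneg x)]

/-- The counterexample map of Section 2 of the paper is Fréchet
differentiable. With `μ({j}) = p_j`, `Σ p_j = 1`, `f` bounded and `C²` with bounded
second derivative, `f(0) = 0`, `f'(0) = 1`, the map `m : L⁴(μ) → L²(μ)`,
`m(α)(j) = f(α(j))`, is well defined and satisfies, with `L = sup|f''|/2`,
`‖m(α) − m(0) − α‖_{L²} ≤ L‖α‖²_{L⁴}`; in particular `m` is Fréchet differentiable at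
`0` with derivative the inclusion `h ↦ h` of `L⁴(μ)` into `L²(μ)`. Here
`‖α‖_{L⁴} = (Σ_j p_j α(j)⁴)^{1/4}` and `‖a‖_{L²} = (Σ_j p_j a(j)²)^{1/2}`. -/
theorem stmt_14 (p : ℕ → ℝ) (hp : ∀ j, 0 < p j) (hpsum : HasSum p 1)
    (f : ℝ → ℝ)
    (hfbdd : ∃ C, ∀ x, |f x| ≤ C)
    (hf : ContDiff ℝ 2 f)
    (hf''bdd : ∃ C, ∀ x, |iteratedDeriv 2 f x| ≤ C)
    (hf0 : f 0 = 0) (hf'0 : deriv f 0 = 1) :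
    (∀ α : ℕ → ℝ, Summable (fun j => p j * (α j) ^ 4) →
      Summable (fun j => p j * (f (α j)) ^ 2) ∧
      Summable (fun j => p j * (f (α j) - f 0 - α j) ^ 2) ∧
      Real.sqrt (∑' j : ℕ, p j * (f (α j) - f 0 - α j) ^ 2) ≤
        ((⨆ x : ℝ, |iteratedDeriv 2 f x|) / 2) *
          Real.sqrt (∑' j : ℕ, p j * (α j) ^ 4)) ∧
    (∀ δ : ℝ, 0 < δ → ∃ ε > 0, ∀ α : ℕ → ℝ, Summable (fun j => p j * (α j) ^ 4) →
      0 < Real.sqrt (Real.sqrt (∑' j : ℕ, p j * (α j) ^ 4)) →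
      Real.sqrt (Real.sqrt (∑' j : ℕ, p j * (α j) ^ 4)) < ε →
      Real.sqrt (∑' j : ℕ, p j * (f (α j) - f 0 - α j) ^ 2) ≤
        δ * Real.sqrt (Real.sqrt (∑' j : ℕ, p j * (α j) ^ 4))) := by
  set M := ⨆ x : ℝ, |iteratedDeriv 2 f x| with hMdef
  have hM0 : 0 ≤ M := Real.iSup_nonneg fun x => abs_nonneg _
  have key : ∀ x, |f x - f 0 - x| ≤ M / 2 * x ^ 2 :=
    aux_pointwise f hf hf''bdd hf'0
  have main : ∀ α : ℕ → ℝ, Summable (fun j => p j * (α j) ^ 4) →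
      Summable (fun j => p j * (f (α j)) ^ 2) ∧
      Summable (fun j => p j * (f (α j) - f 0 - α j) ^ 2) ∧
      Real.sqrt (∑' j : ℕ, p j * (f (α j) - f 0 - α j) ^ 2) ≤
        (M / 2) * Real.sqrt (∑' j : ℕ, p j * (α j) ^ 4) := by
    intro α hα
    have hle : ∀ j, p j * (f (α j) - f 0 - α j) ^ 2 ≤ (M / 2) ^ 2 * (p j * (α j) ^ 4) := by
      intro j
      have h1 : (f (α j) - f 0 - α j) ^ 2 ≤ (M / 2 * (α j) ^ 2) ^ 2 := by
        rw [← sq_abs (f (α j) - f 0 - α j)]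
        exact pow_le_pow_left₀ (abs_nonneg _) (key _) 2
      calc _ ≤ p j * (M / 2 * (α j) ^ 2) ^ 2 := mul_le_mul_of_nonneg_left h1 (hp j).le
        _ = _ := by ring
    have hs : Summable (fun j => p j * (f (α j) - f 0 - α j) ^ 2) :=
      Summable.of_nonneg_of_le (fun j => mul_nonneg (hp j).le (sq_nonneg _)) hle
        (hα.mul_left _)
    refine ⟨?_, hs, ?_⟩
    · obtain ⟨C, hC⟩ := hfbdd
      refine Summable.of_nonneg_of_le (fun j => mul_nonneg (hp j).le (sq_nonneg _))
        (fun j => ?_) (hpsum.summable.mul_right (C ^ 2))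
      refine mul_le_mul_of_nonneg_left ?_ (hp j).le
      rw [← sq_abs (f (α j))]
      exact pow_le_pow_left₀ (abs_nonneg _) (hC _) 2
    · have h2 := hs.tsum_le_tsum hle (hα.mul_left _)
      rw [tsum_mul_left] at h2
      refine (Real.sqrt_le_sqrt h2).trans (le_of_eq ?_)
      rw [Real.sqrt_mul (sq_nonneg _), Real.sqrt_sq (by positivity)]
  refine ⟨main, fun δ hδ => ⟨δ / (M / 2 + 1), by positivity, fun α hα h0 hlt => ?_⟩⟩
  refine (main α hα).2.2.trans ?_
  set S := Real.sqrt (∑' j : ℕ, p j * (α j) ^ 4) with hS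
  have hSS : S = Real.sqrt S * Real.sqrt S := (Real.mul_self_sqrt (Real.sqrt_nonneg _)).symm
  rw [lt_div_iff₀ (by positivity)] at hlt
  have h3 : M / 2 * Real.sqrt S ≤ δ := by nlinarith
  calc M / 2 * S = M / 2 * Real.sqrt S * Real.sqrt S := by rw [mul_assoc, ← hSS]
    _ ≤ δ * Real.sqrt S := mul_le_mul_of_nonneg_right h3 h0.le
end
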